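/- arXiv:2103.07628 — 3 statements merged into one kernel-verified Lean document; each statement's English description precedes it below -/
import Mathlib

section
/- Let Ω = (a,b)×(c,d) with a < b and c < d. If v : ℝ² → ℝ is four times continuously differentiable and vanishes on ∂Ω, then ∫_Ω v · v_xxyy = ∫_Ω (v_xy)². -/
open MeasureTheory Set

/-- Partial derivative with respect to the first variable. -/
noncomputable def pdx (v : ℝ × ℝ → ℝ) : ℝ × ℝ → ℝ :=
  fun p => deriv (fun x => v (x, p.2)) p.1

/-- Partial derivative with respect to the second variable. -/
noncomputable def pdy (v : ℝ × ℝ → ℝ) : ℝ × ℝ → ℝ :=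
  fun p => deriv (fun y => v (p.1, y)) p.2

theorem aux_pdx_eq {v : ℝ × ℝ → ℝ} (hv : Differentiable ℝ v) (p : ℝ × ℝ) :
    HasDerivAt (fun x => v (x, p.2)) (fderiv ℝ v p (1, 0)) p.1 := by
  have h1 : HasFDerivAt v (fderiv ℝ v p) (p.1, p.2) := (hv p).hasFDerivAt
  have h2 : HasDerivAt (fun x : ℝ => (x, p.2)) ((1 : ℝ), (0 : ℝ)) p.1 :=
    (hasDerivAt_id p.1).prodMk (hasDerivAt_const p.1 p.2)
  exact h1.comp_hasDerivAt p.1 h2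

theorem aux_pdy_eq {v : ℝ × ℝ → ℝ} (hv : Differentiable ℝ v) (p : ℝ × ℝ) :
    HasDerivAt (fun y => v (p.1, y)) (fderiv ℝ v p (0, 1)) p.2 := by
  have h1 : HasFDerivAt v (fderiv ℝ v p) (p.1, p.2) := (hv p).hasFDerivAt
  have h2 : HasDerivAt (fun y : ℝ => (p.1, y)) ((0 : ℝ), (1 : ℝ)) p.2 :=
    (hasDerivAt_const p.2 p.1).prodMk (hasDerivAt_id p.2)
  exact h1.comp_hasDerivAt p.2 h2

theorem aux_pdx {v : ℝ × ℝ → ℝ} (hv : Differentiable ℝ v) :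
    pdx v = fun p => fderiv ℝ v p (1, 0) := by
  funext p; exact (aux_pdx_eq hv p).deriv

theorem aux_pdy {v : ℝ × ℝ → ℝ} (hv : Differentiable ℝ v) :
    pdy v = fun p => fderiv ℝ v p (0, 1) := by
  funext p; exact (aux_pdy_eq hv p).deriv

theorem aux_cdx {v : ℝ × ℝ → ℝ} (n m : ℕ) (hv : ContDiff ℝ m v) (h : m = n + 1) :
    ContDiff ℝ n (pdx v) := by
  subst h
  rw [aux_pdx (hv.differentiable (by simp))]
  exact (hv.fderiv_right (m := n) (by simp)).clm_apply contDiff_const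

theorem aux_cdy {v : ℝ × ℝ → ℝ} (n m : ℕ) (hv : ContDiff ℝ m v) (h : m = n + 1) :
    ContDiff ℝ n (pdy v) := by
  subst h
  rw [aux_pdy (hv.differentiable (by simp))]
  exact (hv.fderiv_right (m := n) (by simp)).clm_apply contDiff_const

theorem aux_comm {v : ℝ × ℝ → ℝ} (hv : ContDiff ℝ 2 v) : pdx (pdy v) = pdy (pdx v) := by
  have hd : Differentiable ℝ v := hv.differentiable (by simp)
  have hf : Differentiable ℝ (fderiv ℝ v) :=
    (hv.fderiv_right (m := 1) (by norm_num)).differentiable (by simp)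
  rw [aux_pdy hd, aux_pdx hd]
  rw [aux_pdx (fun p => (hf p).clm_apply (differentiableAt_const _)),
    aux_pdy (fun p => (hf p).clm_apply (differentiableAt_const _))]
  funext p
  have hs : IsSymmSndFDerivAt ℝ v p := hv.contDiffAt.isSymmSndFDerivAt (by simp)
  rw [fderiv_clm_apply (hf p) (differentiableAt_const _),
    fderiv_clm_apply (hf p) (differentiableAt_const _)]
  simpa using hs.eq (1, 0) (0, 1)

theorem aux_int {f : ℝ × ℝ → ℝ} (hf : Continuous f) (a b c d : ℝ) :
    IntegrableOn f (Ioo a b ×ˢ Ioo c d) (volume.prod volume) := by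
  rw [← Measure.volume_eq_prod]
  exact (hf.continuousOn.integrableOn_compact (isCompact_Icc.prod isCompact_Icc)).mono_set
    (prod_mono Ioo_subset_Icc_self Ioo_subset_Icc_self)

theorem aux_fub_y {f : ℝ × ℝ → ℝ} (hf : Continuous f) {a b c d : ℝ} (hcd : c < d) :
    ∫ p in Ioo a b ×ˢ Ioo c d, f p = ∫ x in Ioo a b, ∫ y in c..d, f (x, y) := by
  rw [Measure.volume_eq_prod, setIntegral_prod _ (aux_int hf a b c d)]
  simp_rw [intervalIntegral.integral_of_le hcd.le, integral_Ioc_eq_integral_Ioo]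

theorem aux_fub_x {f : ℝ × ℝ → ℝ} (hf : Continuous f) {a b c d : ℝ} (hab : a < b) :
    ∫ p in Ioo a b ×ˢ Ioo c d, f p = ∫ y in Ioo c d, ∫ x in a..b, f (x, y) := by
  have h := aux_fub_y (f := fun p => f p.swap) (a := c) (b := d) (hf.comp continuous_swap) hab
  rw [Measure.volume_eq_prod] at h ⊢
  exact (setIntegral_prod_swap _ _ f).symm.trans h

theorem aux_ibp_x {a b c d : ℝ} (hab : a < b) {u w : ℝ × ℝ → ℝ}
    (hu : ContDiff ℝ 1 u) (hw : ContDiff ℝ 1 w)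
    (h0 : ∀ y ∈ Ioo c d, u (a, y) = 0 ∧ u (b, y) = 0) :
    ∫ p in Ioo a b ×ˢ Ioo c d, u p * pdx w p = - ∫ p in Ioo a b ×ˢ Ioo c d, pdx u p * w p := by
  have cu := hu.continuous
  have cw := hw.continuous
  have cu' : Continuous (pdx u) := (aux_cdx 0 1 hu rfl).continuous
  have cw' : Continuous (pdx w) := (aux_cdx 0 1 hw rfl).continuous
  have du := hu.differentiable (by simp)
  have dw := hw.differentiable (by simp)
  rw [aux_fub_x (by fun_prop) hab, aux_fub_x (by fun_prop) hab, ← integral_neg]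
  refine setIntegral_congr_fun measurableSet_Ioo fun y hy => ?_
  have := intervalIntegral.integral_mul_deriv_eq_deriv_mul (a := a) (b := b)
    (u := fun x => u (x, y)) (v := fun x => w (x, y))
    (u' := fun x => pdx u (x, y)) (v' := fun x => pdx w (x, y))
    (fun x _ => by rw [aux_pdx du]; exact aux_pdx_eq du (x, y))
    (fun x _ => by rw [aux_pdx dw]; exact aux_pdx_eq dw (x, y))
    (Continuous.intervalIntegrable (by fun_prop) _ _)
    (Continuous.intervalIntegrable (by fun_prop) _ _)
  simpa [(h0 y hy).1, (h0 y hy).2] using this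

theorem aux_ibp_y {a b c d : ℝ} (hcd : c < d) {u w : ℝ × ℝ → ℝ}
    (hu : ContDiff ℝ 1 u) (hw : ContDiff ℝ 1 w)
    (h0 : ∀ x ∈ Ioo a b, u (x, c) = 0 ∧ u (x, d) = 0) :
    ∫ p in Ioo a b ×ˢ Ioo c d, u p * pdy w p = - ∫ p in Ioo a b ×ˢ Ioo c d, pdy u p * w p := by
  have cu := hu.continuous
  have cw := hw.continuous
  have cu' : Continuous (pdy u) := (aux_cdy 0 1 hu rfl).continuous
  have cw' : Continuous (pdy w) := (aux_cdy 0 1 hw rfl).continuous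
  have du := hu.differentiable (by simp)
  have dw := hw.differentiable (by simp)
  rw [aux_fub_y (by fun_prop) hcd, aux_fub_y (by fun_prop) hcd, ← integral_neg]
  refine setIntegral_congr_fun measurableSet_Ioo fun x hx => ?_
  have := intervalIntegral.integral_mul_deriv_eq_deriv_mul (a := c) (b := d)
    (u := fun y => u (x, y)) (v := fun y => w (x, y))
    (u' := fun y => pdy u (x, y)) (v' := fun y => pdy w (x, y))
    (fun y _ => by rw [aux_pdy du]; exact aux_pdy_eq du (x, y))
    (fun y _ => by rw [aux_pdy dw]; exact aux_pdy_eq dw (x, y))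
    (Continuous.intervalIntegrable (by fun_prop) _ _)
    (Continuous.intervalIntegrable (by fun_prop) _ _)
  simpa [(h0 x hx).1, (h0 x hx).2] using this

theorem aux_bd {a b e : ℝ} {v : ℝ × ℝ → ℝ} (h : ∀ x ∈ Icc a b, v (x, e) = 0)
    (x : ℝ) (hx : x ∈ Ioo a b) : pdx v (x, e) = 0 := by
  have : (fun x => v (x, e)) =ᶠ[nhds x] fun _ => (0 : ℝ) := by
    filter_upwards [Icc_mem_nhds hx.1 hx.2] with z hz using h z hz
  simpa [pdx] using this.deriv_eq

theorem stmt_1 (a b c d : ℝ) (hab : a < b) (hcd : c < d)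
    (v : ℝ × ℝ → ℝ) (hv : ContDiff ℝ 4 v)
    (hbc1 : ∀ x ∈ Icc a b, v (x, c) = 0 ∧ v (x, d) = 0)
    (hbc2 : ∀ y ∈ Icc c d, v (a, y) = 0 ∧ v (b, y) = 0) :
    (∫ p in (Ioo a b) ×ˢ (Ioo c d), v p * pdx (pdx (pdy (pdy v))) p) =
      ∫ p in (Ioo a b) ×ˢ (Ioo c d), (pdx (pdy v) p) ^ 2 := by
  have hy : ContDiff ℝ 3 (pdy v) := aux_cdy 3 4 hv rfl
  have hx : ContDiff ℝ 3 (pdx v) := aux_cdx 3 4 hv rfl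
  have hyy : ContDiff ℝ 2 (pdy (pdy v)) := aux_cdy 2 3 hy rfl
  have hxy : ContDiff ℝ 2 (pdx (pdy v)) := aux_cdx 2 3 hy rfl
  have hxyy : ContDiff ℝ 1 (pdx (pdy (pdy v))) := aux_cdx 1 2 hyy rfl
  rw [aux_ibp_x hab (hv.of_le (by norm_num)) hxyy
    (fun y hy => hbc2 y (Ioo_subset_Icc_self hy)),
    aux_comm (hy.of_le (by norm_num)),
    aux_ibp_y hcd (hx.of_le (by norm_num)) (hxy.of_le (by norm_num))
    (fun x hx => ⟨aux_bd (fun z hz => (hbc1 z hz).1) x hx,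
      aux_bd (fun z hz => (hbc1 z hz).2) x hx⟩), neg_neg,
    ← aux_comm (hv.of_le (by norm_num))]
  simp_rw [sq]
end

section
/- For every integer n ≥ 4 and every polynomial p ∈ ℝ[X] of degree at most n−4, ∫_{−1}^{1} (J_n^{−2,−2})′(s)·p(s) ds = 0, where (J_n^{−2,−2})′ denotes the derivative of J_n^{−2,−2} (that is, the derivative of J_n^{−2,−2} is L²(−1,1)-orthogonal to all polynomials of degree at most n−4). -/
open Polynomial

/-- The generalized Jacobi polynomial `J_n^{-2,-2}` for `n ≥ 4`, given by
`J_n^{-2,-2} = ((-1)^n / (2^(n-4) (n-4)!)) · D^(n-4)[(1 - X²)^(n-2)]`. -/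
noncomputable def jacobiM2 (n : ℕ) : Polynomial ℝ :=
  Polynomial.C ((-1 : ℝ) ^ n / (2 ^ (n - 4) * (n - 4).factorial)) *
    (Polynomial.derivative^[n - 4] ((1 - Polynomial.X ^ 2) ^ (n - 2)))


theorem aux_orth (N k : ℕ) (hk : k ≤ N) (q : Polynomial ℝ)
    (hq : Polynomial.derivative^[k] q = 0) :
    (∫ s in (-1 : ℝ)..1,
      (Polynomial.derivative^[k] ((1 - Polynomial.X ^ 2 : Polynomial ℝ) ^ N)).eval s * q.eval s)
      = 0 := by
  induction k generalizing q with
  | zero =>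
    have : q = 0 := by simpa using hq
    simp [this]
  | succ k ih =>
    have h1 := ih (by omega) (Polynomial.derivative q)
      (by rw [← Function.iterate_succ_apply]; exact hq)
    set F := Polynomial.derivative^[k] ((1 - Polynomial.X ^ 2 : Polynomial ℝ) ^ N) with hF
    have hd : (1 - Polynomial.X ^ 2 : Polynomial ℝ) ∣ F :=
      (dvd_pow_self _ (by omega)).trans
        (Polynomial.pow_sub_dvd_iterate_derivative_pow (1 - Polynomial.X ^ 2 : Polynomial ℝ) N k)
    obtain ⟨G, hG⟩ := hd
    have e1 : F.eval 1 = 0 := by rw [hG]; simp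
    have e2 : F.eval (-1) = 0 := by rw [hG]; simp
    have h2 := intervalIntegral.integral_mul_deriv_eq_deriv_mul (a := (-1 : ℝ)) (b := 1)
      (u := fun s => q.eval s) (v := fun s => F.eval s)
      (u' := fun s => (Polynomial.derivative q).eval s)
      (v' := fun s => (Polynomial.derivative F).eval s)
      (fun x _ => q.hasDerivAt x) (fun x _ => F.hasDerivAt x)
      ((Polynomial.derivative q).continuous.intervalIntegrable _ _)
      ((Polynomial.derivative F).continuous.intervalIntegrable _ _)
    rw [Function.iterate_succ_apply', ← hF]
    simp only [e1, e2, mul_comm (Polynomial.eval _ q),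
      mul_comm (Polynomial.eval _ (Polynomial.derivative q)), h1] at h2
    simpa using h2

theorem stmt_9 (n : ℕ) (hn : 4 ≤ n) (p : Polynomial ℝ) (hp : p.degree ≤ ((n - 4 : ℕ) : WithBot ℕ)) :
    (∫ s in (-1 : ℝ)..1, (Polynomial.derivative (jacobiM2 n)).eval s * p.eval s) = 0 := by
  have h := aux_orth (n - 2) (n - 4 + 1) (by omega) p
    (Polynomial.iterate_derivative_eq_zero_of_degree_lt
      (lt_of_le_of_lt hp (by exact_mod_cast Nat.lt_succ_self _)))
  rw [Function.iterate_succ_apply'] at h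
  simp only [jacobiM2, Polynomial.derivative_C_mul, Polynomial.eval_mul, Polynomial.eval_C,
    mul_assoc, intervalIntegral.integral_const_mul, h, mul_zero]
end

section
/- For every integer n ≥ 3 and every s ∈ ℝ, the derivative of the generalized Jacobi polynomial satisfies (J_{n+1}^{−2,−2})′(s) = 4(n−1)(n−2) · φ_n(s); consequently the zeros of (J_{n+1}^{−2,−2})′ are exactly the zeros of the Lobatto polynomial φ_n. -/
open Polynomial

/-- The Legendre polynomial `L_n` given by Rodrigues' formula
`L_n = (1/(2^n n!)) · Dⁿ[(X² - 1)ⁿ]`. -/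
noncomputable def legendreP (n : ℕ) : Polynomial ℝ :=
  Polynomial.C (1 / (2 ^ n * n.factorial : ℝ)) *
    (Polynomial.derivative^[n] ((Polynomial.X ^ 2 - 1) ^ n))

/-- The Lobatto polynomial `φ_m` (for `m ≥ 1`), defined by
`φ_{n+1}(s) = ∫_{-1}^{s} L_n(t) dt`, i.e. `φ_m(s) = ∫_{-1}^{s} L_{m-1}(t) dt`. -/
noncomputable def lobatto (m : ℕ) (s : ℝ) : ℝ :=
  ∫ t in (-1 : ℝ)..s, (legendreP (m - 1)).eval t

lemma aux_zero (k : ℕ) :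
    (Polynomial.derivative^[k+1] ((X ^ 2 - 1 : ℝ[X]) ^ (k+2))).eval (-1) = 0 := by
  have h : (X + 1 : ℝ[X]) ^ (k+2) ∣ (X ^ 2 - 1 : ℝ[X]) ^ (k+2) :=
    pow_dvd_pow_of_dvd ⟨X - 1, by ring⟩ _
  have h2 := Polynomial.pow_sub_dvd_iterate_derivative_of_pow_dvd (k+1) h
  have e : k + 2 - (k + 1) = 1 := by omega
  rw [e, pow_one] at h2
  obtain ⟨q, hq⟩ := h2
  rw [hq]; simp

lemma aux_lob (k : ℕ) (s : ℝ) : lobatto (k+3) s = 1 / (2 ^ (k+2) * (k+2).factorial : ℝ) *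
    (Polynomial.derivative^[k+1] ((X ^ 2 - 1 : ℝ[X]) ^ (k+2))).eval s := by
  unfold lobatto legendreP
  rw [show k + 3 - 1 = k + 2 by omega]
  rw [intervalIntegral.integral_eq_sub_of_hasDerivAt (f := fun t =>
    1 / (2 ^ (k+2) * (k+2).factorial : ℝ) *
    (Polynomial.derivative^[k+1] ((X ^ 2 - 1 : ℝ[X]) ^ (k+2))).eval t)]
  · simp only [aux_zero]; ring
  · intro t _
    rw [eval_mul, eval_C, Function.iterate_succ_apply' _ (k+1)]
    exact (Polynomial.hasDerivAt _ t).const_mul _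
  · exact (Polynomial.continuous _).intervalIntegrable _ _

theorem stmt_14 (n : ℕ) (hn : 3 ≤ n) :
    (∀ s : ℝ, (Polynomial.derivative (jacobiM2 (n + 1))).eval s =
        4 * ((n : ℝ) - 1) * ((n : ℝ) - 2) * lobatto n s) ∧
      {s : ℝ | (Polynomial.derivative (jacobiM2 (n + 1))).eval s = 0} =
        {s : ℝ | lobatto n s = 0} := by
  obtain ⟨k, rfl⟩ : ∃ k, n = k + 3 := ⟨n - 3, by omega⟩
  have main : ∀ s : ℝ, (Polynomial.derivative (jacobiM2 (k + 3 + 1))).eval s =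
        4 * (((k + 3 : ℕ) : ℝ) - 1) * (((k + 3 : ℕ) : ℝ) - 2) * lobatto (k + 3) s := by
    intro s
    rw [aux_lob]
    unfold jacobiM2
    rw [show k + 3 + 1 - 4 = k by omega, show k + 3 + 1 - 2 = k + 2 by omega,
      derivative_C_mul, ← Function.iterate_succ_apply' (⇑derivative) k,
      show (1 - X ^ 2 : ℝ[X]) ^ (k+2) = C ((-1) ^ (k+2)) * (X ^ 2 - 1) ^ (k+2) by
        rw [C_pow, ← mul_pow]; congr 1; simp,
      iterate_derivative_C_mul, eval_mul, eval_mul, eval_C, eval_C,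
      ← mul_assoc, ← mul_assoc]
    congr 1
    have h1 : ((-1 : ℝ)) ^ (k+3+1) * (-1) ^ (k+2) = 1 := by
      rw [← pow_add]; exact Even.neg_one_pow ⟨k+3, by ring⟩
    have hf : (k.factorial : ℝ) ≠ 0 := by positivity
    rw [div_mul_eq_mul_div, h1, Nat.factorial_succ, Nat.factorial_succ]
    push_cast
    have a1 : (k : ℝ) + 1 ≠ 0 := by positivity
    have a2 : (k : ℝ) + 1 + 1 ≠ 0 := by positivity
    field_simp
    ring
  refine ⟨main, ?_⟩
  ext s
  simp only [Set.mem_ofPred_eq]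
  rw [main s]
  have h : 4 * (((k + 3 : ℕ) : ℝ) - 1) * (((k + 3 : ℕ) : ℝ) - 2) ≠ 0 := by
    push_cast
    have e : 4 * ((k : ℝ) + 3 - 1) * ((k : ℝ) + 3 - 2) = 4 * (k + 2) * (k + 1) := by ring
    rw [e]; positivity
  exact mul_eq_zero_iff_left h
end
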